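/- arXiv:1908.02457 — 2 statements merged into one kernel-verified Lean document; each statement's English description precedes it below -/
import Mathlib

section
/- Consider the SOS model on the Cayley tree of order 2 with translation-invariant external field α(x) = α for all x. If J < 0 and α > 0, then the set of ground states is exactly the one-element set consisting of the constant configuration σ(x) = 0 for all x ∈ V; that is, a configuration φ is a ground state if and only if φ(x) = 0 for all x ∈ V. -/
/-- Vertices of the Cayley tree of order 2: reduced words over a three-letter
alphabet, i.e. finite lists over `Fin 3` with no two consecutive letters equal. -/
def CayleyVertex : Type := {l : List (Fin 3) // l.Chain' (· ≠ ·)}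

/-- Two vertices are adjacent iff one word is obtained from the other by
appending a single letter. -/
def CayleyAdj (x y : CayleyVertex) : Prop :=
  (∃ a : Fin 3, x.val = a :: y.val) ∨ (∃ a : Fin 3, y.val = a :: x.val)

/-- The energy of the configuration `σ` on the unit ball centered at `x`:
`U_x(σ) = -(J/2) · Σ_{y ~ x} |σ(y) − σ(x)| + α(x)·σ(x)`. -/
noncomputable def ballEnergy (J : ℝ) (α : CayleyVertex → ℝ)
    (σ : CayleyVertex → Fin 3) (x : CayleyVertex) : ℝ :=
  -(J / 2) * ∑ᶠ y ∈ {y | CayleyAdj x y}, |((σ y : ℕ) : ℝ) - ((σ x : ℕ) : ℝ)|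
    + α x * ((σ x : ℕ) : ℝ)

/-- A configuration `φ` is a ground state if `U_x(φ) ≤ U_y(ψ)` for all
vertices `x, y` and all configurations `ψ`. -/
def IsGroundState (J : ℝ) (α : CayleyVertex → ℝ) (φ : CayleyVertex → Fin 3) : Prop :=
  ∀ (x y : CayleyVertex) (ψ : CayleyVertex → Fin 3),
    ballEnergy J α φ x ≤ ballEnergy J α ψ y

theorem mul_le_ballEnergy {J : ℝ} (hJ : J ≤ 0) (α : CayleyVertex → ℝ)
    (σ : CayleyVertex → Fin 3) (x : CayleyVertex) :
    α x * ((σ x : ℕ) : ℝ) ≤ ballEnergy J α σ x :=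
  le_add_of_nonneg_left <| mul_nonneg (by linarith) <|
    finsum_nonneg fun _ => finsum_nonneg fun _ => abs_nonneg _

theorem ballEnergy_eq_zero (J : ℝ) (α : CayleyVertex → ℝ) {σ : CayleyVertex → Fin 3}
    (hσ : ∀ x, σ x = 0) (x : CayleyVertex) : ballEnergy J α σ x = 0 := by
  simp [ballEnergy, hσ]

/-- If `J < 0` and `α > 0`, then the set of ground states for the SOS model with
translation-invariant external field `α` is exactly `{σ ≡ 0}`. -/
theorem groundState_iff_constant_zero (J a : ℝ) (hJ : J < 0) (ha : 0 < a)
    (φ : CayleyVertex → Fin 3) :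
    IsGroundState J (fun _ => a) φ ↔ ∀ x : CayleyVertex, φ x = 0 := by
  refine ⟨fun h x => ?_, fun h x y ψ => ?_⟩
  · have hle := (mul_le_ballEnergy hJ.le _ φ x).trans (h x x fun _ => 0)
    rw [ballEnergy_eq_zero J _ (fun _ => rfl)] at hle
    have hx : ((φ x : ℕ) : ℝ) ≤ 0 := nonpos_of_mul_nonpos_right hle ha
    exact Fin.ext (Nat.le_zero.mp (by exact_mod_cast hx))
  · rw [ballEnergy_eq_zero J _ h]
    exact (by positivity : 0 ≤ a * ((ψ y : ℕ) : ℝ)).trans (mul_le_ballEnergy hJ.le (fun _ => a) ψ y)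
end

section
/- Consider the SOS model on the Cayley tree of order 2 with the period-two external field α(x) = α₁ for x of even word length and α(x) = α₂ for x of odd word length. If J ≥ 0, α₁ = 0 and α₂ ≥ 0, then the G₂⁽²⁾-periodic configuration σ with σ(x) = 2 for x of even word length and σ(x) = 0 for x of odd word length is a ground state. -/
/-- The neighbor of `x` in direction `a`: delete the first letter if it is `a`,
otherwise put `a` in front. -/
def CayleyVertex.neighbor : CayleyVertex → Fin 3 → CayleyVertex
  | ⟨[], _⟩, a => ⟨[a], List.isChain_singleton a⟩
  | ⟨b :: l, h⟩, a =>
    if hab : a = b then ⟨l, h.tail⟩ else ⟨a :: b :: l, List.isChain_cons_cons.2 ⟨hab, h⟩⟩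

theorem CayleyVertex.val_neighbor_of_val_eq_cons {x : CayleyVertex} {b : Fin 3}
    {l : List (Fin 3)} (hx : x.val = b :: l) (a : Fin 3) :
    (x.neighbor a).val = if a = b then l else a :: b :: l := by
  obtain ⟨_, h⟩ := x
  subst hx
  by_cases hab : a = b
  · exact (congrArg Subtype.val (dif_pos hab)).trans (if_pos hab).symm
  · exact (congrArg Subtype.val (dif_neg hab)).trans (if_neg hab).symm

theorem CayleyVertex.val_neighbor_of_val_eq_nil {x : CayleyVertex} (hx : x.val = [])
    (a : Fin 3) : (x.neighbor a).val = [a] := by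
  obtain ⟨_, h⟩ := x
  subst hx
  rfl

theorem CayleyVertex.neighbor_injective (x : CayleyVertex) :
    Function.Injective x.neighbor := by
  intro a c hac
  have hval := congrArg Subtype.val hac
  cases hx : x.val with
  | nil => simpa [val_neighbor_of_val_eq_nil hx] using hval
  | cons b l =>
    rw [val_neighbor_of_val_eq_cons hx, val_neighbor_of_val_eq_cons hx] at hval
    split_ifs at hval with ha hc hc
    · rw [ha, hc]
    · have hlen := congrArg List.length hval
      simp only [List.length_cons] at hlen
      omega
    · have hlen := congrArg List.length hval
      simp only [List.length_cons] at hlen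
      omega
    · exact (List.cons.inj hval).1

theorem setOf_cayleyAdj_eq_range_neighbor (x : CayleyVertex) :
    {y | CayleyAdj x y} = Set.range x.neighbor := by
  ext y
  change CayleyAdj x y ↔ ∃ a, x.neighbor a = y
  have hrange : (∃ a, x.neighbor a = y) ↔ ∃ a, (x.neighbor a).val = y.val :=
    exists_congr fun a => Subtype.ext_iff
  rw [hrange, CayleyAdj]
  cases hx : x.val with
  | nil =>
    simp only [CayleyVertex.val_neighbor_of_val_eq_nil hx]
    simp [eq_comm]
  | cons b l =>
    simp only [CayleyVertex.val_neighbor_of_val_eq_cons hx]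
    constructor
    · rintro (⟨a, ha⟩ | ⟨a, ha⟩)
      · exact ⟨b, by simp [(List.cons.inj ha).2]⟩
      · have hchain := y.property
        rw [ha] at hchain
        exact ⟨a, by simp [ha, (List.isChain_cons_cons.1 hchain).1]⟩
    · rintro ⟨a, ha⟩
      by_cases hab : a = b
      · exact Or.inl ⟨b, by simp [← ha, hab]⟩
      · exact Or.inr ⟨a, by simp [← ha, hab]⟩

theorem CayleyVertex.cayleyAdj_neighbor (x : CayleyVertex) (a : Fin 3) :
    CayleyAdj x (x.neighbor a) :=
  (setOf_cayleyAdj_eq_range_neighbor x).ge ⟨a, rfl⟩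

/-- Adjacent vertices have word lengths of opposite parity. -/
theorem CayleyAdj.even_length_iff {x y : CayleyVertex} (h : CayleyAdj x y) :
    Even y.val.length ↔ ¬ Even x.val.length := by
  rcases h with ⟨a, ha⟩ | ⟨a, ha⟩ <;> simp [ha, Nat.even_add_one]

theorem ballEnergy_eq_sum_neighbor (J : ℝ) (α : CayleyVertex → ℝ)
    (σ : CayleyVertex → Fin 3) (x : CayleyVertex) :
    ballEnergy J α σ x =
      -(J / 2) * ∑ a, |((σ (x.neighbor a) : ℕ) : ℝ) - ((σ x : ℕ) : ℝ)|
        + α x * ((σ x : ℕ) : ℝ) := by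
  rw [ballEnergy, setOf_cayleyAdj_eq_range_neighbor,
    finsum_mem_range x.neighbor_injective, finsum_eq_sum_of_fintype]

theorem abs_spin_sub_le_two (s t : Fin 3) : |((s : ℕ) : ℝ) - ((t : ℕ) : ℝ)| ≤ 2 := by
  fin_cases s <;> fin_cases t <;> norm_num

/-- For a nonnegative coupling and field, the ball energies are bounded below by `-3J`. -/
theorem neg_three_mul_le_ballEnergy {J : ℝ} {α : CayleyVertex → ℝ} (hJ : 0 ≤ J)
    (hα : ∀ x, 0 ≤ α x) (σ : CayleyVertex → Fin 3) (x : CayleyVertex) :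
    -3 * J ≤ ballEnergy J α σ x := by
  rw [ballEnergy_eq_sum_neighbor]
  have hsum : ∑ a, |((σ (x.neighbor a) : ℕ) : ℝ) - ((σ x : ℕ) : ℝ)| ≤ 6 :=
    (Finset.sum_le_sum fun a _ => abs_spin_sub_le_two _ _).trans (by norm_num)
  have hfield : 0 ≤ α x * ((σ x : ℕ) : ℝ) := mul_nonneg (hα x) (Nat.cast_nonneg _)
  nlinarith

/-- For `J ≥ 0`, `α₁ = 0`, `α₂ ≥ 0`, the `G₂⁽²⁾`-periodic configuration which is `2`
on even words and `0` on odd words is a ground state of the SOS model with the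
period-two external field (`α₁` on even words, `α₂` on odd words). -/
theorem periodic_two_zero_isGroundState (J α₁ α₂ : ℝ)
    (hJ : 0 ≤ J) (h1 : α₁ = 0) (h2 : 0 ≤ α₂) :
    IsGroundState J (fun x => if Even x.val.length then α₁ else α₂)
      (fun x => if Even x.val.length then 2 else 0) := by
  intro x y ψ
  refine le_trans (le_of_eq ?_) (neg_three_mul_le_ballEnergy hJ (fun z => ?_) ψ y)
  · have hnb (a : Fin 3) := (x.cayleyAdj_neighbor a).even_length_iff
    rw [ballEnergy_eq_sum_neighbor]
    by_cases hx : Even x.val.length <;> simp [hnb, hx, h1] <;> ring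
  · split_ifs
    exacts [h1.ge, h2]
end
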